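/- arXiv:2007.14907 — 5 statements merged into one kernel-verified Lean document; each statement's English description precedes it below -/
import Mathlib

section
/- Every lattice homomorphism φ on the Banach lattice c₀ is a nonnegative multiple of a coordinate functional: there exist λ ≥ 0 and n ∈ ℕ such that φ(x) = λ · x(n) for every x ∈ c₀. -/
open scoped ZeroAtInfty

open Filter Topology

/-- The `n`-th unit vector of `c₀`. -/
noncomputable def unitVecC0 (n : ℕ) : C₀(ℕ, ℝ) where
  toFun := Pi.single n 1
  continuous_toFun := continuous_of_discreteTopology
  zero_at_infty' := by
    rw [cocompact_eq_cofinite]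
    refine tendsto_const_nhds.congr' ?_
    filter_upwards [(Set.finite_singleton n).compl_mem_cofinite] with k hk
    exact (Pi.single_eq_of_ne (M := fun _ => ℝ) hk 1).symm

theorem unitVecC0_apply (n k : ℕ) : unitVecC0 n k = if k = n then 1 else 0 :=
  Pi.single_apply n (1 : ℝ) k

theorem sum_smul_unitVecC0_apply (a : ℕ → ℝ) (s : Finset ℕ) (k : ℕ) :
    (∑ n ∈ s, a n • unitVecC0 n) k = if k ∈ s then a k else 0 := by
  classical
  induction s using Finset.induction_on with
  | empty => simp
  | insert m s hm ih =>
    rw [Finset.sum_insert hm, ZeroAtInftyContinuousMap.add_apply, ih,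
      ZeroAtInftyContinuousMap.smul_apply, unitVecC0_apply]
    by_cases hk : k = m
    · subst hk
      simp [hm]
    · simp [hk]

/-- Every element of `c₀` is the sum of its coordinates times the unit vectors. -/
theorem hasSum_smul_unitVecC0 (x : C₀(ℕ, ℝ)) : HasSum (fun n => x n • unitVecC0 n) x := by
  refine ZeroAtInftyContinuousMap.tendsto_iff_tendstoUniformly.2 ?_
  rw [Metric.tendstoUniformly_iff]
  intro ε hε
  have hx : Tendsto x cofinite (𝓝 0) := by
    simpa only [cocompact_eq_cofinite] using zero_at_infty x
  have hfin : {k | ¬ dist (x k) 0 < ε}.Finite := Metric.tendsto_nhds.1 hx ε hε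
  filter_upwards [eventually_ge_atTop hfin.toFinset] with s hs k
  rw [sum_smul_unitVecC0_apply]
  split_ifs with hk
  · simpa using hε
  · by_contra h
    exact hk (hs (hfin.mem_toFinset.2 h))

/-- Every lattice homomorphism on `c₀` (with its coordinatewise order) is a nonnegative
multiple of a coordinate functional. Here the lattice homomorphism property is expressed
coordinatewise, since the order on `c₀` is the coordinatewise one. -/
theorem latticeHom_c0_eq_smul_coord
    (φ : C₀(ℕ, ℝ) →L[ℝ] ℝ)
    (hsup : ∀ x y z : C₀(ℕ, ℝ), (∀ n : ℕ, z n = x n ⊔ y n) → φ z = φ x ⊔ φ y)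
    (hinf : ∀ x y z : C₀(ℕ, ℝ), (∀ n : ℕ, z n = x n ⊓ y n) → φ z = φ x ⊓ φ y) :
    ∃ (l : ℝ) (n : ℕ), 0 ≤ l ∧ ∀ x : C₀(ℕ, ℝ), φ x = l * x n := by
  have hnonneg : ∀ n, 0 ≤ φ (unitVecC0 n) := by
    intro n
    have h := hsup (unitVecC0 n) 0 (unitVecC0 n) fun k => by
      rw [unitVecC0_apply, ZeroAtInftyContinuousMap.zero_apply]
      split_ifs <;> simp
    rw [h, map_zero]
    exact le_sup_right
  have hdisj : ∀ m n, m ≠ n → φ (unitVecC0 m) ⊓ φ (unitVecC0 n) = 0 := by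
    intro m n hmn
    rw [← hinf (unitVecC0 m) (unitVecC0 n) 0, map_zero]
    intro k
    rw [unitVecC0_apply, unitVecC0_apply, ZeroAtInftyContinuousMap.zero_apply]
    split_ifs with h₁ h₂
    · exact absurd (h₁.symm.trans h₂) hmn
    all_goals simp
  obtain ⟨n, hn⟩ : ∃ n, ∀ m, m ≠ n → φ (unitVecC0 m) = 0 := by
    by_cases h : ∃ n, φ (unitVecC0 n) ≠ 0
    · obtain ⟨n, hn⟩ := h
      refine ⟨n, fun m hm => ?_⟩
      rcases min_choice (φ (unitVecC0 m)) (φ (unitVecC0 n)) with h | h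
      · exact h.symm.trans (hdisj m n hm)
      · exact absurd (h.symm.trans (hdisj m n hm)) hn
    · push Not at h
      exact ⟨0, fun m _ => h m⟩
  refine ⟨φ (unitVecC0 n), n, hnonneg n, fun x => ?_⟩
  have hsum : HasSum (fun k => φ (x k • unitVecC0 k)) (φ x) :=
    φ.hasSum (hasSum_smul_unitVecC0 x)
  refine (hsum.unique (hasSum_single n fun m hm => ?_)).trans ?_
  · rw [map_smul, hn m hm, smul_zero]
  · rw [map_smul, smul_eq_mul, mul_comm]
end

section
/- Let 1 ≤ p < ∞. Every lattice homomorphism φ on the Banach lattice ℓ_p is a nonnegative multiple of a coordinate functional: there exist λ ≥ 0 and n ∈ ℕ such that φ(x) = λ · x(n) for every x ∈ ℓ_p. -/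
open scoped ENNReal

/-- Standard unit vectors have nonnegative coordinates. -/
theorem Pi.single_one_apply_nonneg {ι : Type*} [DecidableEq ι] (i m : ι) :
    0 ≤ (Pi.single i (1 : ℝ) : ι → ℝ) m := by
  rw [Pi.single_apply]
  split_ifs <;> norm_num

/-- Distinct standard unit vectors are disjoint. -/
theorem Pi.single_one_inf_single_one {ι : Type*} [DecidableEq ι] {i j : ι} (hij : i ≠ j) (m : ι) :
    (Pi.single i (1 : ℝ) : ι → ℝ) m ⊓ (Pi.single j (1 : ℝ) : ι → ℝ) m = 0 := by
  rcases eq_or_ne m i with rfl | hm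
  · simp [Pi.single_eq_of_ne hij]
  · rw [Pi.single_eq_of_ne hm]
    exact inf_eq_left.mpr (Pi.single_one_apply_nonneg j m)

/-- For `1 ≤ p < ∞`, every lattice homomorphism on `ℓ_p` (with its coordinatewise order)
is a nonnegative multiple of a coordinate functional. Here the lattice homomorphism
property is expressed coordinatewise, since the order on `ℓ_p` is the coordinatewise one. -/
theorem latticeHom_lp_eq_smul_coord
    (p : ℝ≥0∞) [Fact (1 ≤ p)] (hp' : p ≠ ⊤)
    (φ : lp (fun _ : ℕ => ℝ) p →L[ℝ] ℝ)
    (hsup : ∀ x y z : lp (fun _ : ℕ => ℝ) p,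
      (∀ n : ℕ, (z : ∀ _ : ℕ, ℝ) n = (x : ∀ _ : ℕ, ℝ) n ⊔ (y : ∀ _ : ℕ, ℝ) n) →
        φ z = φ x ⊔ φ y)
    (hinf : ∀ x y z : lp (fun _ : ℕ => ℝ) p,
      (∀ n : ℕ, (z : ∀ _ : ℕ, ℝ) n = (x : ∀ _ : ℕ, ℝ) n ⊓ (y : ∀ _ : ℕ, ℝ) n) →
        φ z = φ x ⊓ φ y) :
    ∃ (l : ℝ) (n : ℕ), 0 ≤ l ∧ ∀ x : lp (fun _ : ℕ => ℝ) p, φ x = l * (x : ∀ _ : ℕ, ℝ) n := by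
  set a : ℕ → ℝ := fun k => φ (lp.single p k (1 : ℝ)) with ha
  have hnonneg (k : ℕ) : 0 ≤ a k := by
    have h := hsup (lp.single p k (1 : ℝ)) 0 (lp.single p k (1 : ℝ))
      fun m => (sup_eq_left.mpr (Pi.single_one_apply_nonneg k m)).symm
    rw [map_zero] at h
    exact sup_eq_left.mp h.symm
  have hdisj {i j : ℕ} (hij : i ≠ j) : a i ⊓ a j = 0 := by
    rw [ha, ← map_zero φ]
    refine (hinf (lp.single p i (1 : ℝ)) (lp.single p j (1 : ℝ)) 0 fun m => ?_).symm
    exact (Pi.single_one_inf_single_one hij m).symm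
  obtain ⟨n, hn⟩ : ∃ n, ∀ k, k ≠ n → a k = 0 := by
    by_cases h : ∃ n, a n ≠ 0
    · obtain ⟨n, hn⟩ := h
      refine ⟨n, fun k hk => ?_⟩
      rcases min_choice (a k) (a n) with h | h
      · rw [← h, hdisj hk]
      · exact absurd (h.symm.trans (hdisj hk)) hn
    · push Not at h
      exact ⟨0, fun k _ => h k⟩
  refine ⟨a n, n, hnonneg n, fun x => ?_⟩
  have hterm (k : ℕ) : φ (lp.single p k (x k)) = x k * a k := by
    have : lp.single p k (x k) = x k • lp.single (E := fun _ : ℕ => ℝ) p k (1 : ℝ) := by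
      rw [← lp.single_smul, smul_eq_mul, mul_one]
    rw [this, map_smul, smul_eq_mul]
  have hsum := φ.hasSum (lp.hasSum_single hp' x)
  simp only [hterm] at hsum
  rw [hsum.unique (hasSum_single n fun k hk => by rw [hn k hk, mul_zero]), mul_comm]
end

section
/- Let K be a nonempty compact Hausdorff topological space. Every lattice homomorphism φ on the Banach lattice C(K, ℝ) is a nonnegative multiple of a point evaluation: there exist λ ≥ 0 and a ∈ K such that φ(f) = λ · f(a) for every f ∈ C(K, ℝ). -/
/-- A map preserving binary suprema on `C(K, ℝ)` and vanishing on functions without a common zero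
vanishes on a nowhere vanishing nonnegative function. -/
theorem exists_pos_of_forall_exists_apply_ne_zero
    {K : Type*} [TopologicalSpace K] [CompactSpace K] (φ : C(K, ℝ) →L[ℝ] ℝ)
    (hsup : ∀ f g : C(K, ℝ), φ (f ⊔ g) = φ f ⊔ φ g)
    (h : ∀ a : K, ∃ f : C(K, ℝ), φ f = 0 ∧ f a ≠ 0) :
    ∃ g : C(K, ℝ), φ g = 0 ∧ ∀ x, 0 < g x := by
  suffices H : ∃ g : C(K, ℝ), φ g = 0 ∧ ∀ x ∈ (Set.univ : Set K), 0 < g x by simpa using H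
  refine isCompact_univ.induction_on (p := fun s => ∃ g : C(K, ℝ), φ g = 0 ∧ ∀ x ∈ s, 0 < g x)
    ⟨0, by simp⟩ ?_ ?_ ?_
  · rintro s t hst ⟨g, hg, hpos⟩
    exact ⟨g, hg, fun x hx => hpos x (hst hx)⟩
  · rintro s t ⟨g, hg, hgs⟩ ⟨k, hk, hkt⟩
    refine ⟨g ⊔ k, by simp [hsup, hg, hk], ?_⟩
    rintro x (hx | hx)
    · exact lt_sup_of_lt_left (hgs x hx)
    · exact lt_sup_of_lt_right (hkt x hx)
  · intro a _
    obtain ⟨f, hf, hfa⟩ := h a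
    refine ⟨{x | f x ≠ 0}, mem_nhdsWithin_of_mem_nhds
      ((isOpen_ne_fun f.continuous continuous_const).mem_nhds hfa), f ⊔ -f,
      by simp [hsup, hf], fun x hx => ?_⟩
    exact abs_pos.2 hx

/-- Every lattice homomorphism on `C(K, ℝ)`, for `K` a nonempty compact Hausdorff space,
is a nonnegative multiple of a point evaluation. -/
theorem latticeHom_continuousMap_eq_smul_eval
    (K : Type*) [TopologicalSpace K] [CompactSpace K] [T2Space K] [Nonempty K]
    (φ : C(K, ℝ) →L[ℝ] ℝ)
    (hsup : ∀ f g : C(K, ℝ), φ (f ⊔ g) = φ f ⊔ φ g)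
    (hinf : ∀ f g : C(K, ℝ), φ (f ⊓ g) = φ f ⊓ φ g) :
    ∃ (l : ℝ) (a : K), 0 ≤ l ∧ ∀ f : C(K, ℝ), φ f = l * f a := by
  have hmono : ∀ f g : C(K, ℝ), f ≤ g → φ f ≤ φ g := fun f g hfg => by
    rw [← sup_eq_right, ← hsup, sup_eq_right.2 hfg]
  have hone : 0 ≤ φ 1 := by
    simpa using hmono 0 1 (fun _ => zero_le_one)
  rcases hone.eq_or_lt with h0 | hpos
  · refine ⟨0, Classical.arbitrary K, le_rfl, fun f => ?_⟩
    have hle : ∀ g : C(K, ℝ), φ g ≤ 0 := fun g => by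
      have := hmono g (‖g‖ • 1) fun x => by
        simpa using (le_abs_self _).trans (g.norm_coe_le_norm x)
      simpa [← h0] using this
    have hneg := hle (-f)
    rw [map_neg] at hneg
    linarith [hle f]
  · obtain ⟨a, ha⟩ : ∃ a : K, ∀ f : C(K, ℝ), φ f = 0 → f a = 0 := by
      by_contra! hcon
      obtain ⟨g, hg, hgpos⟩ := exists_pos_of_forall_exists_apply_ne_zero φ hsup hcon
      obtain ⟨b, -, hb⟩ := isCompact_univ.exists_isMinOn Set.univ_nonempty g.continuous.continuousOn
      have := hmono (g b • 1) g fun x => by simpa using hb (Set.mem_univ x)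
      rw [map_smul, hg, smul_eq_mul] at this
      exact this.not_gt (mul_pos (hgpos b) hpos)
    refine ⟨φ 1, a, hone, fun f => ?_⟩
    have := ha (f - (φ f / φ 1) • 1) (by simp [hpos.ne'])
    simp only [ContinuousMap.sub_apply, ContinuousMap.smul_apply, ContinuousMap.one_apply,
      smul_eq_mul, mul_one, sub_eq_zero] at this
    rw [this, mul_div_cancel₀ _ hpos.ne']
end

section
/- Let 1 ≤ p < ∞. The only lattice homomorphism on the Banach lattice L_p[0,1] (the Lp space of the Lebesgue measure on [0,1], with its a.e.-pointwise order) is the zero functional. -/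
open scoped ENNReal
open MeasureTheory

section

open Filter Topology Set

variable {α : Type*} [MeasurableSpace α] {μ : Measure α} {p : ℝ≥0∞}

/-- Indicators of disjoint sets are disjoint elements of the lattice `Lp`. -/
theorem abs_indicatorConstLp_inf_abs_eq_zero {s t : Set α} (hs : MeasurableSet s)
    (ht : MeasurableSet t) (hμs : μ s ≠ ∞) (hμt : μ t ≠ ∞) (hst : Disjoint s t) (c d : ℝ) :
    |indicatorConstLp p hs hμs c| ⊓ |indicatorConstLp p ht hμt d| = 0 := by
  ext1
  filter_upwards [Lp.coeFn_inf |indicatorConstLp p hs hμs c| |indicatorConstLp p ht hμt d|,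
    Lp.coeFn_abs (indicatorConstLp p hs hμs c), Lp.coeFn_abs (indicatorConstLp p ht hμt d),
    indicatorConstLp_coeFn (p := p) (hs := hs) (hμs := hμs) (c := c),
    indicatorConstLp_coeFn (p := p) (hs := ht) (hμs := hμt) (c := d),
    Lp.coeFn_zero ℝ p μ] with x h h₁ h₂ h₃ h₄ h₀
  rw [h, Pi.inf_apply, h₁, h₂, h₃, h₄, h₀, Pi.zero_apply]
  by_cases hx : x ∈ s
  · simp [disjoint_left.1 hst hx]
  · simp [hx]

/-- A linear functional preserving the lattice operations vanishes at one of any two disjoint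
indicators. -/
theorem abs_inf_abs_apply_indicatorConstLp_eq_zero [Fact (1 ≤ p)] (φ : Lp ℝ p μ →L[ℝ] ℝ)
    (hsup : ∀ f g, φ (f ⊔ g) = φ f ⊔ φ g) (hinf : ∀ f g, φ (f ⊓ g) = φ f ⊓ φ g)
    {s t : Set α} (hs : MeasurableSet s) (ht : MeasurableSet t) (hμs : μ s ≠ ∞) (hμt : μ t ≠ ∞)
    (hst : Disjoint s t) (c d : ℝ) :
    |φ (indicatorConstLp p hs hμs c)| ⊓ |φ (indicatorConstLp p ht hμt d)| = 0 := by
  have habs (f : Lp ℝ p μ) : φ |f| = |φ f| := by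
    rw [abs, hsup, map_neg, abs]
  rw [← habs, ← habs, ← hinf, abs_indicatorConstLp_inf_abs_eq_zero hs ht hμs hμt hst, map_zero]

theorem continuous_indicatorConstLp_inter_Iic [Fact (1 ≤ p)] (hp : p ≠ ∞) {μ : Measure ℝ}
    [IsFiniteMeasure μ] (hμ : μ ≤ volume) {s : Set ℝ} (hs : MeasurableSet s) (c : ℝ) :
    Continuous fun x : ℝ ↦
      indicatorConstLp (μ := μ) p (hs.inter (measurableSet_Iic (a := x))) (by finiteness) c := by
  refine continuous_indicatorConstLp_set hp fun x ↦ ?_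
  have hlim : Tendsto (fun y : ℝ ↦ ENNReal.ofReal |x - y|) (𝓝 x) (𝓝 0) := by
    have : Continuous fun y : ℝ ↦ ENNReal.ofReal |x - y| :=
      ENNReal.continuous_ofReal.comp (by fun_prop)
    simpa using this.tendsto x
  refine tendsto_of_tendsto_of_tendsto_of_le_of_le tendsto_const_nhds hlim
    (fun _ ↦ zero_le) fun y ↦ ?_
  rw [← Real.volume_interval]
  refine (measure_mono fun z hz ↦ ?_).trans (hμ _)
  simp only [mem_symmDiff, mem_inter_iff, mem_Iic, mem_uIcc] at hz ⊢
  grind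

/-- A linear functional preserving the lattice operations vanishes at indicators: otherwise, by
the intermediate value theorem, some cut splits the set into two parts with equal nonzero values. -/
theorem latticeHom_indicatorConstLp_eq_zero [Fact (1 ≤ p)] (hp : p ≠ ∞) {μ : Measure ℝ}
    [IsFiniteMeasure μ] (hμ : μ ≤ volume) {a b : ℝ} (hab : ∀ᵐ x ∂μ, x ∈ Icc a b)
    (φ : Lp ℝ p μ →L[ℝ] ℝ)
    (hsup : ∀ f g, φ (f ⊔ g) = φ f ⊔ φ g) (hinf : ∀ f g, φ (f ⊓ g) = φ f ⊓ φ g)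
    {s : Set ℝ} (hs : MeasurableSet s) (hμs : μ s ≠ ∞) (c : ℝ) :
    φ (indicatorConstLp p hs hμs c) = 0 := by
  let F (x : ℝ) : ℝ := φ (indicatorConstLp (μ := μ) p
    (hs.inter (measurableSet_Iic (a := x))) (by finiteness) c)
  have hF : Continuous F :=
    φ.continuous.comp (continuous_indicatorConstLp_inter_Iic hp hμ hs c)
  have hFa : F a = 0 := by
    have h : (s ∩ Iic a : Set ℝ) =ᵐ[μ] (∅ : Set ℝ) := by
      have ha : ∀ᵐ y ∂μ, y ≠ a :=
        (Measure.absolutelyContinuous_of_le hμ).ae_le (Measure.ae_ne volume a)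
      filter_upwards [hab, ha] with y hy hya
      exact propext (iff_of_false (fun h ↦ hya (le_antisymm h.2 hy.1)) id)
    rw [← map_zero φ, ← indicatorConstLp_empty (c := c)]
    exact congrArg φ ((MemLp.toLp_eq_toLp_iff _ _).2 (indicator_ae_eq_of_ae_eq_set h))
  have hFb : F b = φ (indicatorConstLp p hs hμs c) := by
    have h : (s ∩ Iic b : Set ℝ) =ᵐ[μ] s := by
      filter_upwards [hab] with y hy
      exact propext (and_iff_left hy.2)
    exact congrArg φ ((MemLp.toLp_eq_toLp_iff _ _).2 (indicator_ae_eq_of_ae_eq_set h))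
  obtain ⟨x, -, hx⟩ : φ (indicatorConstLp p hs hμs c) / 2 ∈ F '' uIcc a b := by
    refine intermediate_value_uIcc hF.continuousOn ?_
    rw [hFa, hFb, mem_uIcc]
    grind
  have hd : Disjoint (s ∩ Iic x) (s ∩ Ioi x) :=
    (Iic_disjoint_Ioi le_rfl).mono inter_subset_right inter_subset_right
  have hadd := indicatorConstLp_disjoint_union (μ := μ) (p := p) (hs.inter measurableSet_Iic)
    (hs.inter measurableSet_Ioi) (by finiteness) (by finiteness) hd c
  simp only [← inter_union_distrib_left, Iic_union_Ioi, inter_univ] at hadd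
  have hzero := abs_inf_abs_apply_indicatorConstLp_eq_zero φ hsup hinf
    (hs.inter measurableSet_Iic) (hs.inter measurableSet_Ioi) (by finiteness) (by finiteness) hd c c
  have hsum := congrArg φ hadd
  rw [map_add] at hsum
  change _ = F x + _ at hsum
  change |F x| ⊓ _ = _ at hzero
  rw [eq_sub_of_add_eq' hsum.symm, hx, sub_half, min_self, abs_eq_zero] at hzero
  linarith

end

/-- For `1 ≤ p < ∞`, the only lattice homomorphism on `L_p[0,1]` (the `Lp` space of
Lebesgue measure on `[0,1]`, with the a.e.-pointwise order) is the zero functional. -/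
theorem latticeHom_Lp_eq_zero
    (p : ℝ≥0∞) [Fact (1 ≤ p)] (hp' : p ≠ ⊤)
    (φ : Lp ℝ p ((volume : Measure ℝ).restrict (Set.Icc (0 : ℝ) 1)) →L[ℝ] ℝ)
    (hsup : ∀ f g : Lp ℝ p ((volume : Measure ℝ).restrict (Set.Icc (0 : ℝ) 1)),
      φ (f ⊔ g) = φ f ⊔ φ g)
    (hinf : ∀ f g : Lp ℝ p ((volume : Measure ℝ).restrict (Set.Icc (0 : ℝ) 1)),
      φ (f ⊓ g) = φ f ⊓ φ g) :
    φ = 0 := by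
  ext f
  induction f using Lp.induction hp' with
  | indicatorConst c hs hμs =>
    rw [Lp.simpleFunc.coe_indicatorConst]
    exact latticeHom_indicatorConstLp_eq_zero hp' Measure.restrict_le_self
      (ae_restrict_mem measurableSet_Icc) φ hsup hinf hs hμs.ne c
  | add hf hg _ hf0 hg0 => rw [map_add, map_add, hf0, hg0]
  | isClosed => exact isClosed_eq φ.continuous continuous_const
end

section
/- Let T : c₀ → ℓ₁ be the continuous linear map determined by (T x)(n) = x(n) / 2^{n+1} for every x ∈ c₀ and n ∈ ℕ. Then T is a lattice homomorphism (T(x ⊔ y) = T(x) ⊔ T(y) for all x, y), T is a compact operator, ‖T‖ = 1, yet T does not attain its norm: there is no x ∈ c₀ with ‖x‖ ≤ 1 and ‖T x‖ = 1. -/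
open scoped ZeroAtInfty

lemma ZeroAtInftyContinuousMap.norm_apply_le {X E : Type*} [TopologicalSpace X]
    [SeminormedAddCommGroup E] (f : C₀(X, E)) (x : X) : ‖f x‖ ≤ ‖f‖ :=
  f.toBCF.norm_coe_le_norm x

/-- The indicator sequence of the first `N` natural numbers, as an element of `c₀`. -/
noncomputable def initialIndicator (N : ℕ) : C₀(ℕ, ℝ) where
  toFun n := if n < N then 1 else 0
  continuous_toFun := continuous_of_discreteTopology
  zero_at_infty' := by
    rw [Filter.cocompact_eq_cofinite, Nat.cofinite_eq_atTop]
    refine tendsto_const_nhds.congr' ?_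
    filter_upwards [Filter.eventually_ge_atTop N] with n hn
    simp [hn]

lemma initialIndicator_apply (N n : ℕ) :
    initialIndicator N n = if n < N then 1 else 0 := rfl

lemma norm_initialIndicator_le (N : ℕ) : ‖initialIndicator N‖ ≤ 1 := by
  refine (BoundedContinuousFunction.norm_le (f := (initialIndicator N).toBCF) zero_le_one).2
    fun n => ?_
  change ‖initialIndicator N n‖ ≤ 1
  rw [initialIndicator_apply]
  split_ifs <;> simp

lemma lp.hasSum_norm_one {α : Type*} {E : α → Type*} [∀ i, NormedAddCommGroup (E i)]
    (f : lp E 1) : HasSum (fun i => ‖f i‖) ‖f‖ := by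
  simpa using lp.hasSum_norm (by simp) f

lemma hasSum_one_div_two_pow_succ : HasSum (fun n : ℕ => 1 / (2 : ℝ) ^ (n + 1)) 1 := by
  convert hasSum_geometric_two' 1 using 2 with n
  field_simp
  ring

/-- For summable `a`, the map `u ↦ (u n * a n)ₙ` from the cube `[-1, 1]^ℕ` with the product
topology to `ℓ₁` is continuous. -/
lemma continuousOn_tsum_single_mul {a : ℕ → ℝ} (ha : Summable fun n => ‖a n‖) :
    ContinuousOn (fun u : ℕ → ℝ => ∑' n, lp.single (E := fun _ : ℕ => ℝ) 1 n (u n * a n))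
      (Set.univ.pi fun _ => Set.Icc (-1) 1) := by
  refine continuousOn_tsum (u := fun n => ‖a n‖) (fun n => ?_) ha fun n u hu => ?_
  · refine Continuous.continuousOn ?_
    exact (lp.isometry_single (E := fun _ : ℕ => ℝ) (p := 1) n).continuous.comp (by fun_prop)
  · rw [lp.norm_single (by simp), norm_mul]
    exact mul_le_of_le_one_left (norm_nonneg _) (abs_le.2 (hu n trivial))

lemma isCompactOperator_of_apply_eq_mul {a : ℕ → ℝ} (ha : Summable fun n => ‖a n‖)
    (T : C₀(ℕ, ℝ) →L[ℝ] lp (fun _ : ℕ => ℝ) 1)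
    (hT : ∀ (x : C₀(ℕ, ℝ)) (n : ℕ), (T x : ∀ _ : ℕ, ℝ) n = x n * a n) :
    IsCompactOperator T := by
  rw [isCompactOperator_iff_exists_mem_nhds_image_subset_compact]
  refine ⟨Metric.closedBall 0 1, Metric.closedBall_mem_nhds _ one_pos, _,
    (isCompact_univ_pi fun _ => isCompact_Icc).image_of_continuousOn
      (continuousOn_tsum_single_mul ha), ?_⟩
  rintro _ ⟨x, hx, rfl⟩
  refine ⟨x, fun n _ => abs_le.1 ((x.norm_apply_le n).trans (by simpa using hx)), ?_⟩
  simp only [← hT]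
  exact (lp.hasSum_single (by simp) (T x)).tsum_eq

/-- The operator `T : c₀ → ℓ₁` given by `(T x)(n) = x(n) / 2^(n+1)` is a compact lattice
homomorphism of norm one which does not attain its norm. (Lattice operations on `c₀` and
`ℓ₁` are expressed coordinatewise, since the orders are the coordinatewise ones.) -/
theorem compact_latticeHom_c0_to_l1_not_normAttaining
    (T : C₀(ℕ, ℝ) →L[ℝ] lp (fun _ : ℕ => ℝ) 1)
    (hT : ∀ (x : C₀(ℕ, ℝ)) (n : ℕ), (T x : ∀ _ : ℕ, ℝ) n = x n / 2 ^ (n + 1)) :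
    (∀ x y z : C₀(ℕ, ℝ), (∀ n : ℕ, z n = x n ⊔ y n) →
      ∀ n : ℕ, (T z : ∀ _ : ℕ, ℝ) n = (T x : ∀ _ : ℕ, ℝ) n ⊔ (T y : ∀ _ : ℕ, ℝ) n) ∧
    (∀ x y z : C₀(ℕ, ℝ), (∀ n : ℕ, z n = x n ⊓ y n) →
      ∀ n : ℕ, (T z : ∀ _ : ℕ, ℝ) n = (T x : ∀ _ : ℕ, ℝ) n ⊓ (T y : ∀ _ : ℕ, ℝ) n) ∧
    IsCompactOperator T ∧ ‖T‖ = 1 ∧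
    ¬∃ x : C₀(ℕ, ℝ), ‖x‖ ≤ 1 ∧ ‖T x‖ = 1 := by
  have hsum := hasSum_one_div_two_pow_succ
  have hnorm (x : C₀(ℕ, ℝ)) : HasSum (fun n => ‖x n‖ * (1 / 2 ^ (n + 1))) ‖T x‖ := by
    convert lp.hasSum_norm_one (T x) using 2 with n
    rw [hT, norm_div, mul_one_div, norm_pow, Real.norm_ofNat]
  refine ⟨fun x y z h n => ?_, fun x y z h n => ?_, ?_, le_antisymm ?_ ?_, ?_⟩
  · rw [hT, hT, hT, h, max_div_div_right (by positivity)]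
  · rw [hT, hT, hT, h, min_div_div_right (by positivity)]
  · exact isCompactOperator_of_apply_eq_mul (a := fun n => 1 / 2 ^ (n + 1))
      hsum.summable.norm T fun x n => by rw [hT, mul_one_div]
  · refine T.opNorm_le_bound zero_le_one fun x => ?_
    rw [mul_comm]
    refine hasSum_le (fun n => ?_) (hnorm x) (hsum.mul_left ‖x‖)
    exact mul_le_mul_of_nonneg_right (x.norm_apply_le n) (by positivity)
  · refine le_of_tendsto' hsum.tendsto_sum_nat fun N => ?_
    calc ∑ n ∈ Finset.range N, 1 / (2 : ℝ) ^ (n + 1)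
        = ∑ n ∈ Finset.range N, ‖initialIndicator N n‖ * (1 / 2 ^ (n + 1)) :=
          Finset.sum_congr rfl fun n hn => by
            simp [initialIndicator_apply, Finset.mem_range.1 hn]
      _ ≤ ‖T (initialIndicator N)‖ :=
          sum_le_hasSum _ (fun n _ => by positivity) (hnorm _)
      _ ≤ ‖T‖ := T.unit_le_opNorm _ (norm_initialIndicator_le N)
  · rintro ⟨x, hx, hTx⟩
    have hzero : Filter.Tendsto x Filter.atTop (nhds 0) := by
      simpa [Filter.cocompact_eq_cofinite, Nat.cofinite_eq_atTop] using x.zero_at_infty'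
    obtain ⟨m, hm⟩ := (hzero.norm.eventually_lt_const (by simp : ‖(0 : ℝ)‖ < 1)).exists
    refine (hasSum_lt (i := m) (fun n => ?_) ?_ (hnorm x) hsum).ne hTx
    · exact mul_le_of_le_one_left (by positivity) ((x.norm_apply_le n).trans hx)
    · exact mul_lt_of_lt_one_left (by positivity) hm
end
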